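/- Let k be a positive integer, σ ∈ ℝ, and q(t) := c_k·cos(2πk(t+σ)) with c_k := 2^(−1/6)·(πk)^(−1/3). Let W ⊂ C^∞ be the linear span of the constant function 1 together with the functions cos 2πn· and sin 2πn· for 1 ≤ n ≤ k−1. Then W has dimension 2k−1, the quadratic form ξ ↦ ⟨A_qξ, ξ⟩ is negative definite on W, and ⟨A_qξ, ξ⟩ ≥ 0 for every smooth 1-periodic ξ that is L²-orthogonal to W (i.e. ⟨ξ, w⟩ = 0 for all w ∈ W). In particular the Morse index of ℬ at q equals 2k−1. -/

import Mathlib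

open Real

/-- L² inner product of 1-periodic functions: `⟨f,g⟩ = ∫₀¹ f(t)g(t) dt`. -/
noncomputable def ip (f g : ℝ → ℝ) : ℝ := ∫ t in (0:ℝ)..1, f t * g t

/-- The amplitude `c_k = 2^(-1/6) (πk)^(-1/3)`. -/
noncomputable def ck (k : ℕ) : ℝ := 2 ^ (-(1:ℝ)/6) * (Real.pi * k) ^ (-(1:ℝ)/3)

/-- `α_q = ‖q̇‖²/‖q‖² − 1/(2‖q‖⁶)`, with `‖q‖² = ⟨q,q⟩`. -/
noncomputable def alphaQ (q : ℝ → ℝ) : ℝ :=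
  ip (deriv q) (deriv q) / ip q q - 1 / (2 * (ip q q) ^ 3)

/-- The Hessian operator of `ℬ` at a critical point `q`:
`A_q ξ = −ξ̈ + α_q ξ − (2/‖q‖²)(2α_q − 1/‖q‖⁶)⟨q,ξ⟩ q`. -/
noncomputable def Hess (q ξ : ℝ → ℝ) : ℝ → ℝ := fun t =>
  -(deriv (deriv ξ) t) + alphaQ q * ξ t
    - (2 / ip q q) * (2 * alphaQ q - 1 / (ip q q) ^ 3) * ip q ξ * q t

/-- The span `W` of the constant function `1` and the Fourier modes
`cos 2πnt, sin 2πnt` for `1 ≤ n ≤ k − 1`. -/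
noncomputable def Wspan (k : ℕ) : Submodule ℝ (ℝ → ℝ) :=
  Submodule.span ℝ
    (insert (fun _ => (1:ℝ))
      {f : ℝ → ℝ | ∃ n : ℕ, 1 ≤ n ∧ n ≤ k - 1 ∧
        ((f = fun t => Real.cos (2 * π * n * t)) ∨
         (f = fun t => Real.sin (2 * π * n * t)))})

/-- The cosine mode `t ↦ cos (2πnt)`. -/
noncomputable def cosMode (n : ℕ) : ℝ → ℝ := fun t => Real.cos (2 * π * n * t)

/-- The sine mode `t ↦ sin (2πnt)`. -/
noncomputable def sinMode (n : ℕ) : ℝ → ℝ := fun t => Real.sin (2 * π * n * t)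

theorem contDiff_cosMode (n : ℕ) : ContDiff ℝ (⊤ : ℕ∞) (cosMode n) := by
  unfold cosMode; fun_prop

theorem contDiff_sinMode (n : ℕ) : ContDiff ℝ (⊤ : ℕ∞) (sinMode n) := by
  unfold sinMode; fun_prop

theorem periodic_cosMode (n : ℕ) : Function.Periodic (cosMode n) 1 := fun t => by
  have h : 2 * π * n * (t + 1) = 2 * π * n * t + n * (2 * π) := by ring
  simp only [cosMode, h, Real.cos_add_nat_mul_two_pi]

theorem periodic_sinMode (n : ℕ) : Function.Periodic (sinMode n) 1 := fun t => by
  have h : 2 * π * n * (t + 1) = 2 * π * n * t + n * (2 * π) := by ring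
  simp only [sinMode, h, Real.sin_add_nat_mul_two_pi]

theorem ip_comm (f g : ℝ → ℝ) : ip f g = ip g f := by
  simp only [ip, mul_comm]

theorem ip_add_left {f g h : ℝ → ℝ} (hf : Continuous f) (hg : Continuous g)
    (hh : Continuous h) : ip (f + g) h = ip f h + ip g h := by
  simp only [ip, Pi.add_apply, add_mul]
  exact intervalIntegral.integral_add ((hf.mul hh).intervalIntegrable _ _)
    ((hg.mul hh).intervalIntegrable _ _)

theorem ip_smul_left (a : ℝ) (f g : ℝ → ℝ) : ip (a • f) g = a * ip f g := by
  simp only [ip, Pi.smul_apply, smul_eq_mul, mul_assoc, intervalIntegral.integral_const_mul]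

theorem ip_sum_left {ι : Type*} (s : Finset ι) (f : ι → ℝ → ℝ) {g : ℝ → ℝ}
    (hf : ∀ i, Continuous (f i)) (hg : Continuous g) :
    ip (∑ i ∈ s, f i) g = ∑ i ∈ s, ip (f i) g := by
  simp only [ip, Finset.sum_apply, Finset.sum_mul]
  exact intervalIntegral.integral_finsetSum fun i _ => ((hf i).mul hg).intervalIntegrable _ _

theorem ip_self_pos {f : ℝ → ℝ} (hf : Continuous f) (hper : Function.Periodic f 1)
    (hne : f ≠ 0) : 0 < ip f f := by
  obtain ⟨t, ht⟩ := Function.ne_iff.mp hne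
  obtain ⟨s, hs, hst⟩ := hper.exists_mem_Ico₀ one_pos t
  refine intervalIntegral.integral_pos one_pos (hf.mul hf).continuousOn
    (fun x _ => mul_self_nonneg _) ⟨s, ⟨hs.1, hs.2.le⟩, ?_⟩
  exact mul_self_pos.mpr (hst ▸ ht)

/-- A nonconstant shifted mode has mean zero. -/
theorem integral_cos_shifted {j : ℤ} (hj : j ≠ 0) (θ : ℝ) :
    ∫ t in (0:ℝ)..1, Real.cos (2 * π * j * t + θ) = 0 := by
  have hj' : (2 * π * j : ℝ) ≠ 0 := by
    have : (j : ℝ) ≠ 0 := by exact_mod_cast hj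
    positivity
  rw [intervalIntegral.integral_comp_mul_add (fun x => Real.cos x) hj', integral_cos]
  have h : 2 * π * j * 1 + θ = θ + j * (2 * π) := by ring
  rw [h, Real.sin_add_int_mul_two_pi]
  simp

/-- Two shifted modes with frequencies `m ≠ ±n` are orthogonal. -/
theorem integral_cos_mul_cos_shifted {m n : ℤ} (hmn : m ≠ n) (hmn' : m + n ≠ 0) (θ φ : ℝ) :
    ∫ t in (0:ℝ)..1, Real.cos (2 * π * m * t + θ) * Real.cos (2 * π * n * t + φ) = 0 := by
  have h : ∀ t : ℝ, Real.cos (2 * π * m * t + θ) * Real.cos (2 * π * n * t + φ) =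
      Real.cos (2 * π * (m - n : ℤ) * t + (θ - φ)) / 2
        + Real.cos (2 * π * (m + n : ℤ) * t + (θ + φ)) / 2 := fun t => by
    have h₁ : 2 * π * (m - n : ℤ) * t + (θ - φ)
      = (2 * π * m * t + θ) - (2 * π * n * t + φ) := by push_cast; ring
    have h₂ : 2 * π * (m + n : ℤ) * t + (θ + φ)
      = (2 * π * m * t + θ) + (2 * π * n * t + φ) := by push_cast; ring
    rw [h₁, h₂, Real.cos_sub, Real.cos_add _ (_ + _)]; ring
  simp only [h]
  rw [intervalIntegral.integral_add (Continuous.intervalIntegrable (by fun_prop) _ _)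
    (Continuous.intervalIntegrable (by fun_prop) _ _), intervalIntegral.integral_div,
    intervalIntegral.integral_div, integral_cos_shifted (sub_ne_zero.mpr hmn),
    integral_cos_shifted hmn']
  simp

/-- The inner product of two shifted modes of the same nonzero frequency. -/
theorem integral_cos_mul_cos_shifted_self {n : ℤ} (hn : n ≠ 0) (θ φ : ℝ) :
    ∫ t in (0:ℝ)..1, Real.cos (2 * π * n * t + θ) * Real.cos (2 * π * n * t + φ)
      = Real.cos (θ - φ) / 2 := by
  have h : ∀ t : ℝ, Real.cos (2 * π * n * t + θ) * Real.cos (2 * π * n * t + φ) =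
      Real.cos (θ - φ) / 2
        + Real.cos (2 * π * (2 * n : ℤ) * t + (θ + φ)) / 2 := fun t => by
    have h₁ : θ - φ = (2 * π * n * t + θ) - (2 * π * n * t + φ) := by ring
    have h₂ : 2 * π * (2 * n : ℤ) * t + (θ + φ)
      = (2 * π * n * t + θ) + (2 * π * n * t + φ) := by push_cast; ring
    rw [h₁, h₂, Real.cos_sub, Real.cos_add _ (_ + _)]; ring
  simp only [h]
  rw [intervalIntegral.integral_add (Continuous.intervalIntegrable (by fun_prop) _ _)
    (Continuous.intervalIntegrable (by fun_prop) _ _), intervalIntegral.integral_div,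
    intervalIntegral.integral_div, integral_cos_shifted (mul_ne_zero two_ne_zero hn)]
  simp

theorem cosMode_eq_shifted (n : ℕ) (t : ℝ) :
    cosMode n t = Real.cos (2 * π * (n : ℤ) * t + 0) := by
  simp [cosMode]

theorem sinMode_eq_shifted (n : ℕ) (t : ℝ) :
    sinMode n t = Real.cos (2 * π * (n : ℤ) * t + -(π / 2)) := by
  rw [← sub_eq_add_neg, Real.cos_sub_pi_div_two]; simp [sinMode]

theorem ip_cosMode_cosMode {m n : ℕ} (h : m ≠ n) : ip (cosMode m) (cosMode n) = 0 := by
  simp only [ip, cosMode_eq_shifted]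
  exact integral_cos_mul_cos_shifted (by omega) (by omega) _ _

theorem ip_sinMode_sinMode {m n : ℕ} (h : m ≠ n) : ip (sinMode m) (sinMode n) = 0 := by
  simp only [ip, sinMode_eq_shifted]
  exact integral_cos_mul_cos_shifted (by omega) (by omega) _ _

theorem ip_cosMode_sinMode (m n : ℕ) : ip (cosMode m) (sinMode n) = 0 := by
  rcases eq_or_ne m n with rfl | h
  · rcases eq_or_ne m 0 with rfl | h0
    · simp [ip, sinMode]
    · simp only [ip, cosMode_eq_shifted, sinMode_eq_shifted]
      rw [integral_cos_mul_cos_shifted_self (by omega)]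
      simp
  · simp only [ip, cosMode_eq_shifted, sinMode_eq_shifted]
    exact integral_cos_mul_cos_shifted (by omega) (by omega) _ _

theorem cosMode_ne_zero (n : ℕ) : cosMode n ≠ 0 := fun h => by
  simpa [cosMode] using congrFun h 0

theorem sinMode_ne_zero {n : ℕ} (hn : n ≠ 0) : sinMode n ≠ 0 := fun h => by
  have heval := congrFun h (1 / (4 * n))
  have hn' : (n : ℝ) ≠ 0 := by exact_mod_cast hn
  have : 2 * π * n * (1 / (4 * n)) = π / 2 := by field_simp; norm_num
  simp [sinMode, -one_div, this] at heval

/-- The orthogonal family of modes spanning `Wspan k`. -/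
noncomputable def lowMode (k : ℕ) : Fin k ⊕ Fin (k - 1) → ℝ → ℝ :=
  Sum.elim (fun n => cosMode n) (fun n => sinMode (n + 1))

theorem contDiff_lowMode (k : ℕ) (i) : ContDiff ℝ (⊤ : ℕ∞) (lowMode k i) := by
  rcases i with i | i
  exacts [contDiff_cosMode _, contDiff_sinMode _]

theorem periodic_lowMode (k : ℕ) (i) : Function.Periodic (lowMode k i) 1 := by
  rcases i with i | i
  exacts [periodic_cosMode _, periodic_sinMode _]

theorem ip_lowMode_of_ne {k : ℕ} {i j} (hij : i ≠ j) : ip (lowMode k i) (lowMode k j) = 0 := by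
  rcases i with i | i <;> rcases j with j | j <;> simp only [lowMode, Sum.elim_inl, Sum.elim_inr]
  · exact ip_cosMode_cosMode fun h => hij (congrArg _ (Fin.ext h))
  · exact ip_cosMode_sinMode _ _
  · exact (ip_comm _ _).trans (ip_cosMode_sinMode _ _)
  · exact ip_sinMode_sinMode fun h => hij (congrArg _ (Fin.ext (by omega)))

theorem lowMode_ne_zero (k : ℕ) (i) : lowMode k i ≠ 0 := by
  rcases i with i | i
  exacts [cosMode_ne_zero _, sinMode_ne_zero (Nat.succ_ne_zero _)]

theorem linearIndependent_lowMode (k : ℕ) : LinearIndependent ℝ (lowMode k) := by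
  rw [Fintype.linearIndependent_iff]
  intro g hg j
  have hcont : ∀ i, Continuous (lowMode k i) := fun i => (contDiff_lowMode k i).continuous
  have h : ip (∑ i, g i • lowMode k i) (lowMode k j) = g j * ip (lowMode k j) (lowMode k j) := by
    rw [ip_sum_left _ _ (fun i => (hcont i).const_smul _) (hcont j)]
    simp only [ip_smul_left]
    exact Finset.sum_eq_single j (fun i _ hij => by rw [ip_lowMode_of_ne hij, mul_zero]) (by simp)
  rw [hg] at h
  have h0 : ip 0 (lowMode k j) = 0 := by simp [ip]
  exact (mul_eq_zero.mp (h.symm.trans h0)).resolve_right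
    (ip_self_pos (hcont j) (periodic_lowMode k j) (lowMode_ne_zero k j)).ne'

theorem Wspan_eq_span_range {k : ℕ} (hk : 0 < k) :
    Wspan k = Submodule.span ℝ (Set.range (lowMode k)) := by
  rw [Wspan]
  congr 1
  ext f
  simp only [Set.mem_insert_iff, Set.mem_ofPred_eq, Set.mem_range, Sum.exists, lowMode,
    Sum.elim_inl, Sum.elim_inr]
  constructor
  · rintro (rfl | ⟨n, h1, hn, rfl | rfl⟩)
    · exact Or.inl ⟨⟨0, hk⟩, by ext; simp [cosMode]⟩
    · exact Or.inl ⟨⟨n, by omega⟩, rfl⟩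
    · refine Or.inr ⟨⟨n - 1, by omega⟩, ?_⟩
      simp only [Nat.sub_add_cancel h1]
      rfl
  · rintro (⟨n, rfl⟩ | ⟨n, rfl⟩)
    · rcases Nat.eq_zero_or_pos n with h | h
      · exact Or.inl (by ext; simp [cosMode, h])
      · exact Or.inr ⟨n, h, by omega, Or.inl rfl⟩
    · exact Or.inr ⟨n + 1, by omega, by omega, Or.inr rfl⟩

theorem finrank_Wspan {k : ℕ} (hk : 0 < k) : Module.finrank ℝ (Wspan k) = 2 * k - 1 := by
  rw [Wspan_eq_span_range hk, finrank_span_eq_card (linearIndependent_lowMode k)]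
  simp
  omega

theorem contDiff_and_periodic_of_mem_Wspan {k : ℕ} (hk : 0 < k) {w : ℝ → ℝ}
    (hw : w ∈ Wspan k) : ContDiff ℝ (⊤ : ℕ∞) w ∧ Function.Periodic w 1 := by
  rw [Wspan_eq_span_range hk] at hw
  induction hw using Submodule.span_induction with
  | mem x hx =>
    obtain ⟨i, rfl⟩ := hx
    exact ⟨contDiff_lowMode k i, periodic_lowMode k i⟩
  | zero => exact ⟨contDiff_const, fun _ => rfl⟩
  | add x y _ _ hx hy => exact ⟨hx.1.add hy.1, hx.2.add hy.2⟩
  | smul a x _ hx => exact ⟨hx.1.const_smul a, hx.2.smul a⟩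

theorem ip_highMode_of_mem_Wspan {k : ℕ} (hk : 0 < k) {w : ℝ → ℝ} (hw : w ∈ Wspan k)
    {m : ℕ} (hm : k ≤ m) : ip w (cosMode m) = 0 ∧ ip w (sinMode m) = 0 := by
  have hcont : ∀ {v}, v ∈ Submodule.span ℝ (Set.range (lowMode k)) → Continuous v := fun hv =>
    (contDiff_and_periodic_of_mem_Wspan hk (Wspan_eq_span_range hk ▸ hv)).1.continuous
  have hc := (contDiff_cosMode m).continuous
  have hs := (contDiff_sinMode m).continuous
  rw [Wspan_eq_span_range hk] at hw
  induction hw using Submodule.span_induction with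
  | mem x hx =>
    obtain ⟨i | i, rfl⟩ := hx
    · exact ⟨ip_cosMode_cosMode (by omega), ip_cosMode_sinMode _ _⟩
    · exact ⟨(ip_comm _ _).trans (ip_cosMode_sinMode _ _), ip_sinMode_sinMode (by omega)⟩
  | zero => simp [ip]
  | add x y hx' hy' hx hy =>
    simp [ip_add_left (hcont hx') (hcont hy') hc, ip_add_left (hcont hx') (hcont hy') hs, hx, hy]
  | smul a x _ hx => simp [ip_smul_left, hx]

theorem cosMode_mem_Wspan {k n : ℕ} (h : n < k) : cosMode n ∈ Wspan k := by
  rw [Wspan_eq_span_range (by omega)]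
  exact Submodule.subset_span ⟨Sum.inl ⟨n, h⟩, rfl⟩

theorem sinMode_mem_Wspan {k n : ℕ} (h : n < k) : sinMode n ∈ Wspan k := by
  rcases n with _ | n
  · convert (Wspan k).zero_mem
    ext; simp [sinMode]
  · rw [Wspan_eq_span_range (by omega)]
    exact Submodule.subset_span ⟨Sum.inr ⟨n, by omega⟩, rfl⟩

/-- The Fourier coefficients of a real function viewed as a complex one. -/
noncomputable def realFourierCoeff (f : ℝ → ℝ) (n : ℤ) : ℂ :=
  fourierCoeffOn (zero_lt_one' ℝ) (fun t => (f t : ℂ)) n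

theorem hasSum_sq_realFourierCoeff {f : ℝ → ℝ} (hf : Continuous f) :
    HasSum (fun n => ‖realFourierCoeff f n‖ ^ 2) (ip f f) := by
  have hf' : Continuous fun t => (f t : ℂ) := Complex.continuous_ofReal.comp hf
  have hL2 : MeasureTheory.MemLp (fun t => (f t : ℂ)) 2
      (MeasureTheory.volume.restrict (Set.Ioc 0 1)) :=
    (MeasureTheory.memLp_two_iff_integrable_sq_norm hf'.aestronglyMeasurable).mpr
      ((hf'.norm.pow 2).integrableOn_Ioc)
  simpa [ip, realFourierCoeff, ← sq] using hasSum_sq_fourierCoeffOn (zero_lt_one' ℝ) hL2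

theorem realFourierCoeff_eq_zero {f : ℝ → ℝ} (hf : Continuous f) {n : ℤ}
    (hc : ip f (cosMode n.natAbs) = 0) (hs : ip f (sinMode n.natAbs) = 0) :
    realFourierCoeff f n = 0 := by
  obtain ⟨s, hexp⟩ : ∃ s : ℂ, ∀ t : ℝ,
      fourier (-n) (t : AddCircle ((1:ℝ) - 0)) • (f t : ℂ) =
        ((f t * cosMode n.natAbs t : ℝ) : ℂ) + s * ((f t * sinMode n.natAbs t : ℝ) : ℂ) := by
    have hpos : ∀ (m : ℕ) (t : ℝ), Complex.exp (2 * π * Complex.I * m * t) =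
        cosMode m t + sinMode m t * Complex.I := fun m t => by
      rw [show 2 * π * Complex.I * m * t = ((2 * π * m * t : ℝ) : ℂ) * Complex.I by
        push_cast; ring, Complex.exp_mul_I, ← Complex.ofReal_cos, ← Complex.ofReal_sin]
      rfl
    have hneg : ∀ (m : ℕ) (t : ℝ), Complex.exp (-(2 * π * Complex.I * m * t)) =
        cosMode m t - sinMode m t * Complex.I := fun m t => by
      rw [show -(2 * π * Complex.I * m * t) = ((-(2 * π * m * t) : ℝ) : ℂ) * Complex.I by
        push_cast; ring, Complex.exp_mul_I, ← Complex.ofReal_cos, ← Complex.ofReal_sin,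
        Real.cos_neg, Real.sin_neg, Complex.ofReal_neg, neg_mul, ← sub_eq_add_neg]
      rfl
    obtain ⟨m, rfl | rfl⟩ := n.eq_nat_or_neg
    · refine ⟨-Complex.I, fun t => ?_⟩
      rw [fourier_coe_apply]
      simp [hneg]
      ring
    · refine ⟨Complex.I, fun t => ?_⟩
      rw [fourier_coe_apply]
      simp [hpos]
      ring
  rw [realFourierCoeff, fourierCoeffOn_eq_integral]
  simp only [hexp]
  have hcc := (contDiff_cosMode n.natAbs).continuous
  have hsc := (contDiff_sinMode n.natAbs).continuous
  rw [intervalIntegral.integral_add (Continuous.intervalIntegrable (by fun_prop) _ _)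
    (Continuous.intervalIntegrable (by fun_prop) _ _), intervalIntegral.integral_const_mul,
    intervalIntegral.integral_ofReal, intervalIntegral.integral_ofReal]
  rw [ip] at hc hs
  simp [hc, hs]

theorem norm_sq_realFourierCoeff_deriv {f : ℝ → ℝ} (hf : ContDiff ℝ (⊤ : ℕ∞) f)
    (hper : Function.Periodic f 1) (n : ℤ) :
    ‖realFourierCoeff (deriv f) n‖ ^ 2 = (2 * π * n) ^ 2 * ‖realFourierCoeff f n‖ ^ 2 := by
  have hd : Continuous (deriv f) := hf.continuous_deriv (by simp)
  have hderiv : ∀ x, HasDerivAt f (deriv f x) x := fun x =>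
    (hf.differentiable (by simp) x).hasDerivAt
  have h01 : f 1 = f 0 := by simpa using hper 0
  rcases eq_or_ne n 0 with rfl | hn
  · have : realFourierCoeff (deriv f) 0 = 0 := by
      rw [realFourierCoeff, fourierCoeffOn_eq_integral]
      simp only [neg_zero, fourier_zero, one_smul, intervalIntegral.integral_ofReal]
      rw [intervalIntegral.integral_eq_sub_of_hasDerivAt (fun x _ => hderiv x)
        (hd.intervalIntegrable _ _), h01]
      simp
    simp [this]
  · have key := fourierCoeffOn_of_hasDerivAt (zero_lt_one' ℝ) hn
      (f := fun t => (f t : ℂ)) (f' := fun t => ((deriv f t : ℝ) : ℂ))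
      (fun x _ => (hderiv x).ofReal_comp)
      ((Complex.continuous_ofReal.comp hd).intervalIntegrable _ _)
    rw [h01, sub_self, mul_zero, zero_sub] at key
    have hn' : (n : ℂ) ≠ 0 := by exact_mod_cast hn
    have hpi : (π : ℂ) ≠ 0 := by exact_mod_cast Real.pi_ne_zero
    have key' : realFourierCoeff (deriv f) n
        = (2 * π * n * Complex.I) * realFourierCoeff f n := by
      rw [realFourierCoeff, realFourierCoeff, key]
      field_simp
      simp
    rw [key', norm_mul, mul_pow]
    congr 1
    simp [mul_pow]

theorem hasSum_sq_realFourierCoeff_deriv {f : ℝ → ℝ} (hf : ContDiff ℝ (⊤ : ℕ∞) f)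
    (hper : Function.Periodic f 1) :
    HasSum (fun n : ℤ => (2 * π * n) ^ 2 * ‖realFourierCoeff f n‖ ^ 2)
      (ip (deriv f) (deriv f)) := by
  simpa only [norm_sq_realFourierCoeff_deriv hf hper] using
    hasSum_sq_realFourierCoeff (hf.continuous_deriv (by simp))

/-- Wirtinger's inequality for functions orthogonal to the modes of order `< k`. -/
theorem wirtinger_of_low_modes_eq_zero {k : ℕ} {f : ℝ → ℝ} (hf : ContDiff ℝ (⊤ : ℕ∞) f)
    (hper : Function.Periodic f 1)
    (hlow : ∀ m < k, ip f (cosMode m) = 0 ∧ ip f (sinMode m) = 0) :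
    (2 * π * k) ^ 2 * ip f f ≤ ip (deriv f) (deriv f) := by
  refine hasSum_le (fun n => ?_) ((hasSum_sq_realFourierCoeff hf.continuous).mul_left _)
    (hasSum_sq_realFourierCoeff_deriv hf hper)
  rcases lt_or_ge n.natAbs k with h | h
  · simp [realFourierCoeff_eq_zero hf.continuous (hlow _ h).1 (hlow _ h).2]
  · have : (k : ℝ) ^ 2 ≤ (n : ℝ) ^ 2 := by
      rw [← Int.cast_pow, ← Int.natAbs_sq, Int.cast_pow, Int.cast_natCast]
      gcongr
    simp only [mul_pow]
    gcongr

/-- The reverse inequality for functions orthogonal to the modes of order `≥ k`. -/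
theorem reverse_wirtinger_of_high_modes_eq_zero {k : ℕ} {f : ℝ → ℝ}
    (hf : ContDiff ℝ (⊤ : ℕ∞) f) (hper : Function.Periodic f 1)
    (hhigh : ∀ m, k ≤ m → ip f (cosMode m) = 0 ∧ ip f (sinMode m) = 0) :
    ip (deriv f) (deriv f) ≤ (2 * π * (k - 1)) ^ 2 * ip f f := by
  refine hasSum_le (fun n => ?_) (hasSum_sq_realFourierCoeff_deriv hf hper)
    ((hasSum_sq_realFourierCoeff hf.continuous).mul_left _)
  rcases lt_or_ge n.natAbs k with h | h
  · have h' : (n.natAbs : ℝ) ≤ k - 1 := by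
      rw [le_sub_iff_add_le]; exact_mod_cast h
    have : (n : ℝ) ^ 2 ≤ ((k : ℝ) - 1) ^ 2 := by
      rw [← Int.cast_pow, ← Int.natAbs_sq, Int.cast_pow, Int.cast_natCast]
      gcongr
    simp only [mul_pow]
    gcongr
  · simp [realFourierCoeff_eq_zero hf.continuous (hhigh _ h).1 (hhigh _ h).2]

/-- The quadratic form of the Hessian after integration by parts. -/
theorem ip_Hess_self {q ξ : ℝ → ℝ} (hq : Continuous q) (hξ : ContDiff ℝ (⊤ : ℕ∞) ξ)
    (hper : Function.Periodic ξ 1) :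
    ip (Hess q ξ) ξ = ip (deriv ξ) (deriv ξ) + alphaQ q * ip ξ ξ
      - (2 / ip q q) * (2 * alphaQ q - 1 / (ip q q) ^ 3) * ip q ξ ^ 2 := by
  have hd : ContDiff ℝ (⊤ : ℕ∞) (deriv ξ) := (contDiff_infty_iff_deriv.mp hξ).2
  have hdd : Continuous (deriv (deriv ξ)) := hd.continuous_deriv (by simp)
  have hdper : deriv ξ 1 = deriv ξ 0 := by
    have h := deriv_comp_add_const (f := ξ) 1 0
    rw [funext hper] at h
    simpa using h.symm
  have hparts := intervalIntegral.integral_mul_deriv_eq_deriv_mul (a := 0) (b := 1)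
    (fun x _ => (hξ.differentiable (by simp) x).hasDerivAt)
    (fun x _ => (hd.differentiable (by simp) x).hasDerivAt)
    (hd.continuous.intervalIntegrable _ _) (hdd.intervalIntegrable _ _)
  rw [hdper, show ξ 1 = ξ 0 by simpa using hper 0, sub_self, zero_sub] at hparts
  have hξc := hξ.continuous
  set C := (2 / ip q q) * (2 * alphaQ q - 1 / (ip q q) ^ 3) * ip q ξ with hC
  have hsplit : ∀ t, Hess q ξ t * ξ t =
      -(ξ t * deriv (deriv ξ) t) + alphaQ q * (ξ t * ξ t) - C * (q t * ξ t) := fun t => by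
    simp only [Hess]; ring
  have hI : ip (Hess q ξ) ξ = -(∫ t in (0:ℝ)..1, ξ t * deriv (deriv ξ) t)
      + alphaQ q * ip ξ ξ - C * ip q ξ := by
    unfold ip at hC ⊢
    simp only [hsplit]
    rw [intervalIntegral.integral_sub (Continuous.intervalIntegrable (by fun_prop) _ _)
      (Continuous.intervalIntegrable (by fun_prop) _ _),
      intervalIntegral.integral_add (Continuous.intervalIntegrable (by fun_prop) _ _)
      (Continuous.intervalIntegrable (by fun_prop) _ _), intervalIntegral.integral_neg,
      intervalIntegral.integral_const_mul, intervalIntegral.integral_const_mul]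
  have hDir : ∫ t in (0:ℝ)..1, deriv ξ t * deriv ξ t = ip (deriv ξ) (deriv ξ) := rfl
  rw [hI, hparts, hC, hDir]
  ring

theorem ck_pow_six (k : ℕ) : ck k ^ 6 = 1 / (2 * (π * k) ^ 2) := by
  have hk : 0 ≤ π * k := by positivity
  rw [ck, mul_pow, ← Real.rpow_natCast, ← Real.rpow_natCast, ← Real.rpow_mul zero_le_two,
    ← Real.rpow_mul hk]
  norm_num
  ring

section ShiftedCosine

variable {k : ℕ} {σ : ℝ} {q : ℝ → ℝ}

theorem ip_self_of_shifted_cosine (hk : 0 < k)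
    (hq : ∀ t, q t = ck k * Real.cos (2 * π * k * (t + σ))) : ip q q = ck k ^ 2 / 2 := by
  have h : ∀ t, q t * q t = ck k ^ 2 * (Real.cos (2 * π * (k : ℤ) * t + 2 * π * k * σ)
      * Real.cos (2 * π * (k : ℤ) * t + 2 * π * k * σ)) := fun t => by
    rw [hq, mul_add, Int.cast_natCast]; ring
  simp only [ip, h]
  rw [intervalIntegral.integral_const_mul, integral_cos_mul_cos_shifted_self (by omega)]
  simp [div_eq_mul_inv]

theorem ip_deriv_of_shifted_cosine (hk : 0 < k)
    (hq : ∀ t, q t = ck k * Real.cos (2 * π * k * (t + σ))) :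
    ip (deriv q) (deriv q) = (2 * π * k) ^ 2 * ip q q := by
  have hd : ∀ t, deriv q t = -(2 * π * k * ck k) *
      Real.cos (2 * π * (k : ℤ) * t + (2 * π * k * σ - π / 2)) := fun t => by
    rw [← add_sub_assoc, Real.cos_sub_pi_div_two, Int.cast_natCast, ← mul_add, funext hq]
    have h := (((hasDerivAt_id t).add_const σ).const_mul (2 * π * k)).cos.const_mul (ck k)
    refine h.deriv.trans ?_
    simp only [id]
    ring
  have h : ∀ t, deriv q t * deriv q t = (2 * π * k * ck k) ^ 2 *
      (Real.cos (2 * π * (k : ℤ) * t + (2 * π * k * σ - π / 2))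
        * Real.cos (2 * π * (k : ℤ) * t + (2 * π * k * σ - π / 2))) := fun t => by
    rw [hd]; ring
  rw [ip_self_of_shifted_cosine hk hq]
  simp only [ip, h]
  rw [intervalIntegral.integral_const_mul, integral_cos_mul_cos_shifted_self (by omega),
    sub_self, Real.cos_zero]
  ring

theorem inv_ip_self_cube_of_shifted_cosine (hk : 0 < k)
    (hq : ∀ t, q t = ck k * Real.cos (2 * π * k * (t + σ))) :
    1 / ip q q ^ 3 = 4 * (2 * π * k) ^ 2 := by
  have h : (ck k ^ 2 / 2) ^ 3 = ck k ^ 6 / 8 := by ring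
  have hk' : (k : ℝ) ≠ 0 := by exact_mod_cast hk.ne'
  rw [ip_self_of_shifted_cosine hk hq, h, ck_pow_six]
  field_simp
  norm_num

theorem ip_self_pos_of_shifted_cosine (hk : 0 < k)
    (hq : ∀ t, q t = ck k * Real.cos (2 * π * k * (t + σ))) : 0 < ip q q := by
  have hck : 0 < ck k := by
    have : 0 < π * k := by positivity
    unfold ck; positivity
  rw [ip_self_of_shifted_cosine hk hq]
  positivity

theorem alphaQ_of_shifted_cosine (hk : 0 < k)
    (hq : ∀ t, q t = ck k * Real.cos (2 * π * k * (t + σ))) :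
    alphaQ q = -(2 * π * k) ^ 2 := by
  have h : 1 / (2 * ip q q ^ 3) = 1 / ip q q ^ 3 / 2 := by ring
  rw [alphaQ, ip_deriv_of_shifted_cosine hk hq, h, inv_ip_self_cube_of_shifted_cosine hk hq,
    mul_div_cancel_right₀ _ (ip_self_pos_of_shifted_cosine hk hq).ne']
  ring

theorem ip_Hess_self_of_shifted_cosine (hk : 0 < k)
    (hq : ∀ t, q t = ck k * Real.cos (2 * π * k * (t + σ))) {ξ : ℝ → ℝ}
    (hξ : ContDiff ℝ (⊤ : ℕ∞) ξ) (hper : Function.Periodic ξ 1) :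
    ip (Hess q ξ) ξ = ip (deriv ξ) (deriv ξ) - (2 * π * k) ^ 2 * ip ξ ξ
      + 12 * (2 * π * k) ^ 2 / ip q q * ip q ξ ^ 2 := by
  have hqc : Continuous q := by rw [funext hq]; fun_prop
  rw [ip_Hess_self hqc hξ hper, inv_ip_self_cube_of_shifted_cosine hk hq,
    alphaQ_of_shifted_cosine hk hq]
  ring

theorem ip_shifted_cosine_of_mem_Wspan (hk : 0 < k)
    (hq : ∀ t, q t = ck k * Real.cos (2 * π * k * (t + σ))) {w : ℝ → ℝ} (hw : w ∈ Wspan k) :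
    ip q w = 0 := by
  have h : q = (ck k * Real.cos (2 * π * k * σ)) • cosMode k
      + (-(ck k * Real.sin (2 * π * k * σ))) • sinMode k := by
    ext t
    simp only [hq, mul_add, Real.cos_add, cosMode, sinMode, Pi.add_apply, Pi.smul_apply,
      smul_eq_mul]
    ring
  obtain ⟨hc, hs⟩ := ip_highMode_of_mem_Wspan hk hw le_rfl
  rw [h, ip_add_left ((contDiff_cosMode k).continuous.const_smul _)
    ((contDiff_sinMode k).continuous.const_smul _)
    (contDiff_and_periodic_of_mem_Wspan hk hw).1.continuous, ip_smul_left, ip_smul_left,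
    ip_comm _ w, ip_comm _ w, hc, hs]
  simp

end ShiftedCosine

/-- The Morse index of `ℬ` at `q(t) = c_k cos(2πk(t+σ))` equals `2k−1`: the Hessian
quadratic form is negative definite on the `(2k−1)`-dimensional space `W` spanned by
the constant and the modes of order `< k`, and nonnegative on the L²-orthogonal
complement of `W` among smooth 1-periodic functions. -/
theorem morse_index_of_shifted_cosine (k : ℕ) (hk : 0 < k) (σ : ℝ) (q : ℝ → ℝ)
    (hq : ∀ t, q t = ck k * Real.cos (2 * π * k * (t + σ))) :
    Module.finrank ℝ (Wspan k) = 2 * k - 1 ∧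
    (∀ w ∈ Wspan k, w ≠ 0 → ip (Hess q w) w < 0) ∧
    (∀ ξ : ℝ → ℝ, ContDiff ℝ (⊤ : ℕ∞) ξ → Function.Periodic ξ 1 →
      (∀ w ∈ Wspan k, ip ξ w = 0) → 0 ≤ ip (Hess q ξ) ξ) := by
  refine ⟨finrank_Wspan hk, fun w hw hne => ?_, fun ξ hξ hper horth => ?_⟩
  · obtain ⟨hsmooth, hper⟩ := contDiff_and_periodic_of_mem_Wspan hk hw
    have hpos := ip_self_pos hsmooth.continuous hper hne
    have hle := reverse_wirtinger_of_high_modes_eq_zero hsmooth hper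
      fun m hm => ip_highMode_of_mem_Wspan hk hw hm
    have hlt : (2 * π * ((k : ℝ) - 1)) ^ 2 < (2 * π * k) ^ 2 := by
      have hk' : (1 : ℝ) ≤ k := by exact_mod_cast hk
      have : 0 ≤ (k : ℝ) - 1 := by linarith
      gcongr
      linarith
    rw [ip_Hess_self_of_shifted_cosine hk hq hsmooth hper,
      ip_shifted_cosine_of_mem_Wspan hk hq hw]
    have := mul_lt_mul_of_pos_right hlt hpos
    linarith
  · have hle := wirtinger_of_low_modes_eq_zero hξ hper fun m (hm : m < k) =>
      ⟨horth _ (cosMode_mem_Wspan hm), horth _ (sinMode_mem_Wspan hm)⟩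
    have hq0 := ip_self_pos_of_shifted_cosine hk hq
    rw [ip_Hess_self_of_shifted_cosine hk hq hξ hper]
    have : 0 ≤ 12 * (2 * π * k) ^ 2 / ip q q * ip q ξ ^ 2 := by positivity
    linarith
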